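/- Let R ≥ 4, ‖A‖ ≤ R (spectral norm), ‖x‖_2 ≤ R, ‖y‖_2 ≤ R, ‖b‖_1 ≤ 1, β ∈ (0, 0.1), and suppose ⟨exp(Ax) + Ax, 1_n⟩ ≥ β and ⟨exp(Ay) + Ay, 1_n⟩ ≥ β. Set R_f = 6β^{-2}·n·exp(3R²) and R_{f,2} = 2√n·β^{-1}·exp(R²). Then the vector c̃(x) = K(x)^⊤ c(x) satisfies ‖c̃(x) − c̃(y)‖_2 ≤ 5√n·R_f·R_{f,2}·‖x − y‖_2. -/

import Mathlib

open Matrix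

/-- Euclidean (ℓ₂) norm of a vector in ℝ^m. -/
noncomputable def vecNorm2 {m : ℕ} (v : Fin m → ℝ) : ℝ := Real.sqrt (∑ i, (v i) ^ 2)

/-- ℓ₁ norm of a vector in ℝ^m. -/
noncomputable def vecNorm1 {m : ℕ} (v : Fin m → ℝ) : ℝ := ∑ i, |v i|

/-- Spectral norm of a matrix: operator norm of the induced map between Euclidean spaces. -/
noncomputable def specNorm {m k : ℕ} (A : Matrix (Fin m) (Fin k) ℝ) : ℝ :=
  ‖(Matrix.toEuclideanLin A).toContinuousLinearMap‖

/-- Loewner order: `U ⪯ V` iff `vᵀ U v ≤ vᵀ V v` for all vectors `v`. -/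
def loewnerLE {m : ℕ} (U V : Matrix (Fin m) (Fin m) ℝ) : Prop :=
  ∀ v : Fin m → ℝ, v ⬝ᵥ (U *ᵥ v) ≤ v ⬝ᵥ (V *ᵥ v)

variable {n d : ℕ}

/-- `exp(Ax)`, the entrywise exponential of `A x`. -/
noncomputable def expv (A : Matrix (Fin n) (Fin d) ℝ) (x : Fin d → ℝ) : Fin n → ℝ :=
  fun j => Real.exp (A.mulVec x j)

/-- `u(x) = exp(Ax) + Ax`. -/
noncomputable def uf (A : Matrix (Fin n) (Fin d) ℝ) (x : Fin d → ℝ) : Fin n → ℝ :=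
  fun j => expv A x j + A.mulVec x j

/-- `α(x) = ⟨u(x), 1_n⟩`. -/
noncomputable def alphaf (A : Matrix (Fin n) (Fin d) ℝ) (x : Fin d → ℝ) : ℝ :=
  ∑ j, uf A x j

/-- `f(x) = α(x)⁻¹ u(x)`. -/
noncomputable def ff (A : Matrix (Fin n) (Fin d) ℝ) (x : Fin d → ℝ) : Fin n → ℝ :=
  (alphaf A x)⁻¹ • uf A x

/-- `v_i(x) = (exp(Ax) + 1_n) ∘ A_{*,i}`. -/
noncomputable def vf (A : Matrix (Fin n) (Fin d) ℝ) (i : Fin d) (x : Fin d → ℝ) : Fin n → ℝ :=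
  fun j => (expv A x j + 1) * A j i

/-- `c(x) = f(x) - b`. -/
noncomputable def cf (A : Matrix (Fin n) (Fin d) ℝ) (b : Fin n → ℝ) (x : Fin d → ℝ) : Fin n → ℝ :=
  fun j => ff A x j - b j

/-- `L(x) = 0.5 ‖c(x)‖₂²`. -/
noncomputable def Lf (A : Matrix (Fin n) (Fin d) ℝ) (b : Fin n → ℝ) (x : Fin d → ℝ) : ℝ :=
  0.5 * ∑ j, (cf A b x j) ^ 2

/-- `z(x) = exp(Ax) + 1_n`. -/
noncomputable def zf (A : Matrix (Fin n) (Fin d) ℝ) (x : Fin d → ℝ) : Fin n → ℝ :=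
  fun j => expv A x j + 1

/-- `K(x) = I_n - f(x) · 1_nᵀ`. -/
noncomputable def Kf (A : Matrix (Fin n) (Fin d) ℝ) (x : Fin d → ℝ) : Matrix (Fin n) (Fin n) ℝ :=
  1 - vecMulVec (ff A x) (fun _ => 1)

/-- `c̃(x) = K(x)ᵀ c(x)`. -/
noncomputable def ctf (A : Matrix (Fin n) (Fin d) ℝ) (b : Fin n → ℝ) (x : Fin d → ℝ) : Fin n → ℝ :=
  (Kf A x)ᵀ *ᵥ cf A b x

/-- `B_mat(x) = α(x)⁻² diag(z(x)) K(x)ᵀ K(x) diag(z(x))`. -/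
noncomputable def Bmat (A : Matrix (Fin n) (Fin d) ℝ) (x : Fin d → ℝ) : Matrix (Fin n) (Fin n) ℝ :=
  ((alphaf A x) ^ 2)⁻¹ • (diagonal (zf A x) * (Kf A x)ᵀ * Kf A x * diagonal (zf A x))

/-- `B_rank(x) = α(x)⁻² (z(x) c̃(x)ᵀ diag(z(x)) + diag(z(x)) c̃(x) z(x)ᵀ)`. -/
noncomputable def Brank (A : Matrix (Fin n) (Fin d) ℝ) (b : Fin n → ℝ) (x : Fin d → ℝ) :
    Matrix (Fin n) (Fin n) ℝ :=
  ((alphaf A x) ^ 2)⁻¹ •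
    (vecMulVec (zf A x) (ctf A b x) * diagonal (zf A x)
      + diagonal (zf A x) * vecMulVec (ctf A b x) (zf A x))

/-- `B_diag(x) = α(x)⁻¹ diag(c̃(x) ∘ exp(Ax))`. -/
noncomputable def Bdiag (A : Matrix (Fin n) (Fin d) ℝ) (b : Fin n → ℝ) (x : Fin d → ℝ) :
    Matrix (Fin n) (Fin n) ℝ :=
  (alphaf A x)⁻¹ • diagonal (fun j => ctf A b x j * expv A x j)

/-- `B(x) = B_mat(x) - B_rank(x) + B_diag(x)`. -/
noncomputable def Bf (A : Matrix (Fin n) (Fin d) ℝ) (b : Fin n → ℝ) (x : Fin d → ℝ) :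
    Matrix (Fin n) (Fin n) ℝ :=
  Bmat A x - Brank A b x + Bdiag A b x

/-- Hessian matrix of the loss `L`, with `H(x)_{ij} = ∂²L/∂x_i∂x_j`. -/
noncomputable def Hf (A : Matrix (Fin n) (Fin d) ℝ) (b : Fin n → ℝ) (x : Fin d → ℝ) :
    Matrix (Fin d) (Fin d) ℝ :=
  Matrix.of fun i j =>
    fderiv ℝ (fun y => fderiv ℝ (Lf A b) y (Pi.single j 1)) x (Pi.single i 1)

lemma vn_eq {m : ℕ} (v : Fin m → ℝ) : vecNorm2 v = ‖WithLp.toLp 2 v‖ := by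
  rw [EuclideanSpace.norm_eq]; simp [vecNorm2]

lemma vn_nonneg {m : ℕ} (v : Fin m → ℝ) : 0 ≤ vecNorm2 v := Real.sqrt_nonneg _

lemma vn_add {m : ℕ} (v w : Fin m → ℝ) : vecNorm2 (v + w) ≤ vecNorm2 v + vecNorm2 w := by
  simp only [vn_eq, WithLp.toLp_add]; exact norm_add_le _ _

lemma vn_sub {m : ℕ} (v w : Fin m → ℝ) : vecNorm2 (v - w) ≤ vecNorm2 v + vecNorm2 w := by
  simp only [vn_eq, WithLp.toLp_sub]; exact norm_sub_le _ _

lemma vn_smul {m : ℕ} (c : ℝ) (v : Fin m → ℝ) : vecNorm2 (c • v) = |c| * vecNorm2 v := by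
  simp only [vn_eq, WithLp.toLp_smul, norm_smul, Real.norm_eq_abs]

lemma vn_dot {m : ℕ} (v w : Fin m → ℝ) : |v ⬝ᵥ w| ≤ vecNorm2 v * vecNorm2 w := by
  have h := Real.sum_mul_le_sqrt_mul_sqrt Finset.univ v w
  have h2 := Real.sum_mul_le_sqrt_mul_sqrt Finset.univ (fun i => -v i) w
  simp only [vecNorm2, dotProduct, abs_le]
  simp only [neg_mul, Finset.sum_neg_distrib, neg_sq] at h2
  constructor <;> linarith

lemma vn_one (m : ℕ) : vecNorm2 (fun _ : Fin m => (1:ℝ)) = Real.sqrt m := by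
  simp [vecNorm2]

lemma vn_mono {m : ℕ} (v w : Fin m → ℝ) (h : ∀ i, |v i| ≤ |w i|) : vecNorm2 v ≤ vecNorm2 w :=
  Real.sqrt_le_sqrt (Finset.sum_le_sum fun i _ => sq_le_sq.2 (h i))

lemma vn_coord {m : ℕ} (v : Fin m → ℝ) (i : Fin m) : |v i| ≤ vecNorm2 v := by
  rw [← Real.sqrt_sq_eq_abs]
  exact Real.sqrt_le_sqrt (Finset.single_le_sum (f := fun i => (v i)^2)
    (fun i _ => sq_nonneg _) (Finset.mem_univ i))

lemma vn_le_one {m : ℕ} (b : Fin m → ℝ) : vecNorm2 b ≤ vecNorm1 b := by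
  apply Real.sqrt_le_iff.2
  refine ⟨Finset.sum_nonneg fun i _ => abs_nonneg _, ?_⟩
  have : ∀ i, (b i)^2 ≤ |b i| * vecNorm1 b := fun i => by
    rw [← sq_abs, sq]
    exact mul_le_mul_of_nonneg_left
      (Finset.single_le_sum (f := fun i => |b i|) (fun i _ => abs_nonneg _) (Finset.mem_univ i))
      (abs_nonneg _)
  calc _ ≤ ∑ i, |b i| * vecNorm1 b := Finset.sum_le_sum fun i _ => this i
    _ = _ := by rw [← Finset.sum_mul, sq]; rfl

lemma vn_mulVec {m k : ℕ} (A : Matrix (Fin m) (Fin k) ℝ) (x : Fin k → ℝ) :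
    vecNorm2 (A *ᵥ x) ≤ specNorm A * vecNorm2 x := by
  have := (Matrix.toEuclideanLin A).toContinuousLinearMap.le_opNorm (WithLp.toLp 2 x)
  rw [vn_eq, vn_eq, specNorm]
  exact this

lemma exp_lip (a c M : ℝ) (ha : a ≤ M) (hc : c ≤ M) :
    |Real.exp a - Real.exp c| ≤ Real.exp M * |a - c| := by
  wlog h : c ≤ a generalizing a c
  · rw [abs_sub_comm, abs_sub_comm a]; exact this c a hc ha (by linarith)
  have h1 : Real.exp c ≤ Real.exp a := Real.exp_le_exp.2 h
  rw [abs_of_nonneg (by linarith), abs_of_nonneg (by linarith)]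
  have h2 := Real.add_one_le_exp (c - a)
  have h3 : Real.exp c = Real.exp a * Real.exp (c - a) := by rw [← Real.exp_add]; ring_nf
  have h4 : Real.exp a ≤ Real.exp M := Real.exp_le_exp.2 ha
  have h5 := Real.exp_pos a
  nlinarith

lemma ctf_eq {n d : ℕ} (A : Matrix (Fin n) (Fin d) ℝ) (b : Fin n → ℝ) (x : Fin d → ℝ) :
    ctf A b x = (ff A x - b) - (ff A x ⬝ᵥ (ff A x - b)) • (fun _ => (1:ℝ)) := by
  have : cf A b x = ff A x - b := rfl
  rw [ctf, this, Kf, Matrix.transpose_sub, Matrix.sub_mulVec, Matrix.transpose_one,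
    Matrix.one_mulVec]
  congr 1
  ext i
  simp [Matrix.mulVec, dotProduct, vecMulVec_apply]

set_option maxHeartbeats 2000000 in
/-- ‖c̃(x) − c̃(y)‖₂ ≤ 5√n·R_f·R_{f,2}·‖x − y‖₂,
where R_f = 6β⁻²·n·exp(3R²) and R_{f,2} = 2√n·β⁻¹·exp(R²). -/
theorem stmt18 (n d : ℕ) (A : Matrix (Fin n) (Fin d) ℝ) (b : Fin n → ℝ) (x y : Fin d → ℝ)
    (R β : ℝ) (hR : 4 ≤ R) (hA : specNorm A ≤ R) (hx : vecNorm2 x ≤ R) (hy : vecNorm2 y ≤ R)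
    (hb : vecNorm1 b ≤ 1) (hβ0 : 0 < β) (hβ1 : β < 0.1)
    (hβx : β ≤ alphaf A x) (hβy : β ≤ alphaf A y) :
    vecNorm2 (ctf A b x - ctf A b y)
      ≤ 5 * Real.sqrt n * (6 * (β ^ 2)⁻¹ * (n : ℝ) * Real.exp (3 * R ^ 2)) *
          (2 * Real.sqrt n * β⁻¹ * Real.exp (R ^ 2)) * vecNorm2 (x - y) := by
  have hR0 : 0 < R := by linarith
  set e := Real.exp (R ^ 2) with he
  have hee : R ^ 2 + 1 ≤ e := Real.add_one_le_exp _
  have he3 : Real.exp (3 * R ^ 2) = e ^ 3 := by rw [he, ← Real.exp_nat_mul]; norm_num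
  have hRe : R ≤ e := by nlinarith
  have he1 : 17 ≤ e := by nlinarith
  have hn : 1 ≤ (n:ℝ) := by
    rcases Nat.eq_zero_or_pos n with h | h
    · subst h
      simp [alphaf] at hβx
      linarith
    · exact_mod_cast h
  set s := Real.sqrt n with hs
  have hs1 : 1 ≤ s := Real.one_le_sqrt.2 hn
  have hss : s * s = n := Real.mul_self_sqrt (by linarith)
  have hAv : ∀ v, vecNorm2 (A *ᵥ v) ≤ R * vecNorm2 v := fun v =>
    (vn_mulVec A v).trans (mul_le_mul_of_nonneg_right hA (vn_nonneg v))
  have hco : ∀ v, vecNorm2 v ≤ R → ∀ j, |(A *ᵥ v) j| ≤ R ^ 2 := fun v hv j => by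
    have h1 := vn_coord (A *ᵥ v) j
    have h2 := hAv v
    nlinarith
  have hub : ∀ v, vecNorm2 v ≤ R → vecNorm2 (uf A v) ≤ 2 * e * s := fun v hv => by
    have : vecNorm2 (uf A v) ≤ vecNorm2 ((2 * e) • (fun _ : Fin n => (1:ℝ))) := by
      apply vn_mono
      intro j
      have h1 := hco v hv j
      have h2 : Real.exp ((A *ᵥ v) j) ≤ e := Real.exp_le_exp.2 (abs_le.1 h1).2
      have h3 := Real.exp_pos ((A *ᵥ v) j)
      have h4 := abs_le.1 h1
      simp only [uf, expv, Pi.smul_apply, smul_eq_mul, mul_one]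
      rw [abs_of_pos (by linarith : 0 < 2 * e), abs_le]
      constructor <;> linarith
    rw [vn_smul, vn_one, abs_of_pos (by linarith)] at this
    exact this
  set δ := vecNorm2 (x - y) with hδ
  have hδ0 : 0 ≤ δ := vn_nonneg _
  set U := vecNorm2 (uf A x - uf A y) with hU
  have hU0 : 0 ≤ U := vn_nonneg _
  have hUle : U ≤ (e + 1) * (R * δ) := by
    have h1 : U ≤ vecNorm2 ((e + 1) • (A *ᵥ (x - y))) := by
      apply vn_mono
      intro j
      have h1 := exp_lip ((A *ᵥ x) j) ((A *ᵥ y) j) (R ^ 2) (abs_le.1 (hco x hx j)).2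
        (abs_le.1 (hco y hy j)).2
      simp only [uf, expv, Pi.smul_apply, Pi.sub_apply, smul_eq_mul, Matrix.mulVec_sub]
      rw [abs_mul, abs_of_pos (by linarith : 0 < e + 1)]
      calc _ = |(Real.exp ((A *ᵥ x) j) - Real.exp ((A *ᵥ y) j)) + ((A *ᵥ x) j - (A *ᵥ y) j)| := by
            ring_nf
        _ ≤ _ := abs_add_le _ _
        _ ≤ _ := by linarith
    rw [vn_smul, abs_of_pos (by linarith)] at h1
    exact h1.trans (mul_le_mul_of_nonneg_left (hAv _) (by linarith))
  have hα : |alphaf A x - alphaf A y| ≤ s * U := by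
    have h1 := vn_dot (fun _ : Fin n => (1:ℝ)) (uf A x - uf A y)
    rw [vn_one] at h1
    convert h1 using 2
    simp [alphaf, dotProduct]
  have hi : ∀ v, β ≤ alphaf A v → |(alphaf A v)⁻¹| ≤ β⁻¹ := fun v hv => by
    rw [abs_of_pos (inv_pos.2 (by linarith))]
    exact inv_anti₀ hβ0 hv
  have hβi : 10 ≤ β⁻¹ := by
    rw [le_inv_comm₀ (by norm_num) hβ0]; norm_num at hβ1 ⊢; linarith
  set g := β⁻¹ with hg
  set Q := 2 * s * g * e with hQ
  have hfb : ∀ v, vecNorm2 v ≤ R → β ≤ alphaf A v → vecNorm2 (ff A v) ≤ Q := fun v hv hv' => by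
    rw [ff, vn_smul]
    calc _ ≤ g * (2 * e * s) := mul_le_mul (hi v hv') (hub v hv) (vn_nonneg _) (by linarith)
      _ = Q := by rw [hQ]; ring
  set D := vecNorm2 (ff A x - ff A y) with hD
  have hD0 : 0 ≤ D := vn_nonneg _
  have hDU : D ≤ g * U + g * g * (s * U) * (2 * e * s) := by
    have hax : alphaf A x ≠ 0 := by linarith
    have hay : alphaf A y ≠ 0 := by linarith
    have h1 : ff A x - ff A y = (alphaf A x)⁻¹ • (uf A x - uf A y)
        - ((alphaf A x)⁻¹ * (alphaf A y)⁻¹ * (alphaf A x - alphaf A y)) • uf A y := by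
      ext j
      simp only [ff, Pi.sub_apply, Pi.smul_apply, smul_eq_mul]
      field_simp
      ring
    rw [hD, h1]
    refine (vn_sub _ _).trans ?_
    rw [vn_smul, vn_smul, abs_mul, abs_mul]
    have hix := hi x hβx
    have hiy := hi y hβy
    have hu := hub y hy
    have := vn_nonneg (uf A y)
    gcongr
  have hDle : D ≤ 6 * g ^ 2 * n * e ^ 3 * δ := by
    have hn0 : 0 ≤ (n:ℝ) := by linarith
    have h1 : D ≤ (g * g * n) * (3 * e) * U := by
      have : g * U + g * g * (s * U) * (2 * e * s) = (g + g * g * n * (2 * e)) * U := by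
        rw [← hss]; ring
      rw [this] at hDU
      refine hDU.trans (mul_le_mul_of_nonneg_right ?_ hU0)
      have h2 : g ≤ g * g * n * e := by
        have a1 : 1 ≤ g * n := by nlinarith
        have a2 : 1 ≤ g * n * e := by nlinarith
        nlinarith
      linarith
    have h2 : U ≤ (2 * e) * (e * δ) := hUle.trans (by gcongr; linarith)
    calc D ≤ (g * g * n) * (3 * e) * U := h1
      _ ≤ (g * g * n) * (3 * e) * ((2 * e) * (e * δ)) := by
        apply mul_le_mul_of_nonneg_left h2; positivity
      _ = _ := by ring
  have hQ1 : 1 ≤ Q := by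
    have a1 : 1 ≤ s * g := by nlinarith
    have a2 : 1 ≤ s * g * e := by nlinarith
    rw [hQ]; linarith
  have hfin : vecNorm2 (ctf A b x - ctf A b y) ≤ D + (2 * Q + 1) * D * s := by
    have h1 : ctf A b x - ctf A b y = (ff A x - ff A y)
        - ((ff A x + ff A y - b) ⬝ᵥ (ff A x - ff A y)) • (fun _ => (1:ℝ)) := by
      have h2 : (ff A x + ff A y - b) ⬝ᵥ (ff A x - ff A y)
          = ff A x ⬝ᵥ (ff A x - b) - ff A y ⬝ᵥ (ff A y - b) := by
        simp only [dotProduct, ← Finset.sum_sub_distrib, Pi.sub_apply, Pi.add_apply]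
        exact Finset.sum_congr rfl fun i _ => by ring
      rw [h2, ctf_eq, ctf_eq, sub_smul]
      abel
    rw [h1]
    refine (vn_sub _ _).trans ?_
    rw [vn_smul, vn_one]
    have h3 := vn_dot (ff A x + ff A y - b) (ff A x - ff A y)
    have h4 : vecNorm2 (ff A x + ff A y - b) ≤ 2 * Q + 1 := by
      have := vn_sub (ff A x + ff A y) b
      have := vn_add (ff A x) (ff A y)
      have := hfb x hx hβx
      have := hfb y hy hβy
      have := vn_le_one b
      linarith
    have h5 := h3.trans (mul_le_mul_of_nonneg_right h4 hD0)
    have := mul_le_mul_of_nonneg_right h5 (by linarith : 0 ≤ s)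
    linarith
  have h6 : D + (2 * Q + 1) * D * s ≤ 5 * s * Q * D := by
    have a1 : 1 ≤ s * Q := by nlinarith
    have a2 : s ≤ s * Q := by nlinarith
    have : 1 + (2 * Q + 1) * s ≤ 5 * s * Q := by nlinarith
    nlinarith
  rw [he3, ← inv_pow]
  calc _ ≤ 5 * s * Q * D := hfin.trans h6
    _ ≤ 5 * s * Q * (6 * g ^ 2 * n * e ^ 3 * δ) := by
      apply mul_le_mul_of_nonneg_left hDle; nlinarith
    _ = _ := by ring
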